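/- Let T be the linear operator on the 28-dimensional space Λ²(ℝ⁸)* of alternating 2-forms on ℝ⁸ defined by the requirement α ∧ β ∧ Φ₀ = ⟨T(α), β⟩ · vol for all 2-forms α, β (where the inner product on 2-forms makes {dx^i ∧ dx^j : i < j} an orthonormal basis). Then T is self-adjoint and Λ²(ℝ⁸)* is the orthogonal direct sum of the eigenspace Λ²₇ of T for the eigenvalue 3, which has dimension 7, and the eigenspace Λ²₂₁ for the eigenvalue −1, which has dimension 21. -/

import Mathlib

noncomputable section
open scoped RealInnerProductSpace

/-- Euclidean 8-space ℝ⁸. -/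
abbrev E8 : Type := EuclideanSpace ℝ (Fin 8)

/-- The alternating 4-form `dx^i ∧ dx^j ∧ dx^k ∧ dx^l` on ℝ⁸, evaluated on four vectors. -/
def dx4 (i j k l : Fin 8) (v : Fin 4 → E8) : ℝ :=
  Matrix.det (Matrix.of fun a b => v b (![i, j, k, l] a))

/-- The Cayley 4-form `Φ₀` on ℝ⁸ (indices written 0-based, i.e. `dx4 0 1 2 3` is `dx¹²³⁴`). -/
def Phi0 (v : Fin 4 → E8) : ℝ :=
  dx4 0 1 2 3 v + dx4 0 1 4 5 v + dx4 0 1 6 7 v + dx4 0 2 4 6 v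
    - dx4 0 2 5 7 v - dx4 0 3 4 7 v - dx4 0 3 5 6 v
    - dx4 1 2 4 7 v - dx4 1 2 5 6 v - dx4 1 3 4 6 v
    + dx4 1 3 5 7 v + dx4 2 3 4 5 v + dx4 2 3 6 7 v + dx4 4 5 6 7 v

/-- The wedge product of a `p`-form and a `q`-form on ℝ⁸ (forms represented as
functions of tuples of vectors), in the determinant convention: for alternating
`f` and `g` this is the usual exterior product, with `dx¹ ∧ ⋯ ∧ dx⁸ = vol`. -/
def wedge {p q : ℕ} (f : (Fin p → E8) → ℝ) (g : (Fin q → E8) → ℝ)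
    (v : Fin (p + q) → E8) : ℝ :=
  ((p.factorial * q.factorial : ℕ) : ℝ)⁻¹ *
    ∑ σ : Equiv.Perm (Fin (p + q)),
      ((Equiv.Perm.sign σ : ℤ) : ℝ) *
        ((f fun i => v (σ (Fin.castAdd q i))) * g fun j => v (σ (Fin.natAdd p j)))

/-- The standard volume form `vol = dx¹ ∧ ⋯ ∧ dx⁸` on ℝ⁸. -/
def vol (v : Fin 8 → E8) : ℝ := Matrix.det (Matrix.of fun a b => v b a)

/-- The space `Λ²(ℝ⁸)*` of alternating 2-forms on ℝ⁸. -/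
abbrev Lambda2 : Type := AlternatingMap ℝ E8 ℝ (Fin 2)

/-- The inner product on 2-forms making `{dxⁱ ∧ dxʲ : i < j}` an orthonormal basis. -/
def ip2 (α β : Lambda2) : ℝ :=
  ∑ i : Fin 8, ∑ j : Fin 8,
    if i < j then
      α ![EuclideanSpace.single i 1, EuclideanSpace.single j 1] *
        β ![EuclideanSpace.single i 1, EuclideanSpace.single j 1]
    else 0

theorem wedge_eq_of_support {p q : ℕ} {f : (Fin p → E8) → ℝ} {g : (Fin q → E8) → ℝ}
    (hf : ∀ v (τ : Equiv.Perm (Fin p)), f (v ∘ τ) = ((Equiv.Perm.sign τ : ℤ) : ℝ) * f v)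
    (hg : ∀ v (τ : Equiv.Perm (Fin q)), g (v ∘ τ) = ((Equiv.Perm.sign τ : ℤ) : ℝ) * g v)
    (v : Fin (p + q) → E8) (ρ : Equiv.Perm (Fin (p + q)))
    (h : ∀ σ : Equiv.Perm (Fin (p + q)), (g fun j => v (σ (Fin.natAdd p j))) ≠ 0 →
      ∀ j, ∃ k, σ (Fin.natAdd p j) = ρ (Fin.natAdd p k)) :
    wedge f g v = ((Equiv.Perm.sign ρ : ℤ) : ℝ) *
      ((f fun i => v (ρ (Fin.castAdd q i))) * g fun j => v (ρ (Fin.natAdd p j))) := by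
  set block : Equiv.Perm (Fin p) × Equiv.Perm (Fin q) → Equiv.Perm (Fin (p + q)) := fun s =>
    ρ * finSumFinEquiv.permCongr (Equiv.Perm.sumCongr s.1 s.2) with hblock
  have hinj : Function.Injective block := fun s t hst =>
    Equiv.Perm.sumCongrHom_injective (finSumFinEquiv.permCongr.injective (mul_left_cancel hst))
  have hsq (n : ℕ) (τ : Equiv.Perm (Fin n)) :
      ((Equiv.Perm.sign τ : ℤ) : ℝ) * ((Equiv.Perm.sign τ : ℤ) : ℝ) = 1 := by
    exact_mod_cast Int.units_coe_mul_self _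
  unfold wedge
  rw [← Fintype.sum_of_injective block hinj (fun _ => ((Equiv.Perm.sign ρ : ℤ) : ℝ) *
      ((f fun i => v (ρ (Fin.castAdd q i))) * g fun j => v (ρ (Fin.natAdd p j))))]
  · rw [Finset.sum_const, Finset.card_univ, Fintype.card_prod, Fintype.card_perm,
      Fintype.card_perm, Fintype.card_fin, Fintype.card_fin, nsmul_eq_mul, inv_mul_cancel_left₀]
    positivity
  · intro σ hσ
    by_contra hne
    refine hσ ?_
    have hg0 : (g fun j => v (σ (Fin.natAdd p j))) ≠ 0 := by
      intro h0
      simp [h0] at hne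
    obtain ⟨⟨s, t⟩, hst⟩ := Equiv.Perm.mem_sumCongrHom_range_of_perm_mapsTo_inl
      (σ := finSumFinEquiv.symm.permCongr (ρ⁻¹ * σ)) (by
        rw [Equiv.Perm.perm_mapsTo_inl_iff_mapsTo_inr]
        rintro _ ⟨j, rfl⟩
        obtain ⟨k, hk⟩ := h σ hg0 j
        exact ⟨k, by simp [Equiv.permCongr_apply, hk]⟩)
    refine ⟨(s, t), ?_⟩
    rw [Equiv.Perm.sumCongrHom_apply] at hst
    simp only at hst
    rw [hblock]
    simp only [hst]
    ext x
    simp [Equiv.permCongr_apply]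
  · rintro ⟨s, t⟩
    have h1 := hf (fun i => v (ρ (Fin.castAdd q i))) s
    have h2 := hg (fun j => v (ρ (Fin.natAdd p j))) t
    simp only [Function.comp_def] at h1 h2
    simp only [hblock, Equiv.Perm.coe_mul, Function.comp_apply, Equiv.permCongr_apply,
      finSumFinEquiv_symm_apply_castAdd, finSumFinEquiv_symm_apply_natAdd, Equiv.Perm.sumCongr_apply,
      Sum.map_inl, Sum.map_inr, finSumFinEquiv_apply_left, finSumFinEquiv_apply_right, h1, h2,
      map_mul, Equiv.Perm.sign_permCongr, Equiv.Perm.sign_sumCongr, Units.val_mul, Int.cast_mul]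
    linear_combination (-((Equiv.Perm.sign ρ : ℤ) : ℝ) *
      ((f fun i => v (ρ (Fin.castAdd q i))) * g fun j => v (ρ (Fin.natAdd p j)))) *
      (((Equiv.Perm.sign t : ℤ) : ℝ) * ((Equiv.Perm.sign t : ℤ) : ℝ) * hsq p s + hsq q t)

theorem dx4_comp_perm (i j k l : Fin 8) (v : Fin 4 → E8) (τ : Equiv.Perm (Fin 4)) :
    dx4 i j k l (v ∘ τ) = ((Equiv.Perm.sign τ : ℤ) : ℝ) * dx4 i j k l v :=
  Matrix.det_permute' τ (Matrix.of fun a b => v b (![i, j, k, l] a))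

theorem wedge_dx4_single {f : (Fin 4 → E8) → ℝ}
    (hf : ∀ v (τ : Equiv.Perm (Fin 4)), f (v ∘ τ) = ((Equiv.Perm.sign τ : ℤ) : ℝ) * f v)
    (ρ : Equiv.Perm (Fin 8)) :
    wedge (p := 4) (q := 4) f (dx4 (ρ 4) (ρ 5) (ρ 6) (ρ 7)) (fun i => EuclideanSpace.single i 1) =
      ((Equiv.Perm.sign ρ : ℤ) : ℝ) *
        f ![EuclideanSpace.single (ρ 0) 1, EuclideanSpace.single (ρ 1) 1,
          EuclideanSpace.single (ρ 2) 1, EuclideanSpace.single (ρ 3) 1] := by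
  have hρ (a : Fin 4) : ![ρ 4, ρ 5, ρ 6, ρ 7] a = ρ (Fin.natAdd 4 a) := by fin_cases a <;> rfl
  have h1 : dx4 (ρ 4) (ρ 5) (ρ 6) (ρ 7)
      (fun j => EuclideanSpace.single (ρ (Fin.natAdd 4 j)) 1) = 1 := by
    rw [dx4, ← Matrix.det_one (n := Fin 4)]
    congr 1
    ext a b
    simp [hρ, Matrix.one_apply, -Fin.natAdd_eq_addNat, Fin.ext_iff]
  rw [wedge_eq_of_support hf (dx4_comp_perm _ _ _ _) _ ρ]
  · rw [h1, mul_one]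
    congr 2
    ext i : 1
    fin_cases i <;> rfl
  · intro σ hσ j
    by_contra! hne
    refine hσ (Matrix.det_eq_zero_of_column_eq_zero j fun a => ?_)
    simp [hρ, (hne a).symm, -Fin.natAdd_eq_addNat]

theorem wedge_comp_perm {p q : ℕ} (f : (Fin p → E8) → ℝ) (g : (Fin q → E8) → ℝ)
    (v : Fin (p + q) → E8) (τ : Equiv.Perm (Fin (p + q))) :
    wedge f g (v ∘ τ) = ((Equiv.Perm.sign τ : ℤ) : ℝ) * wedge f g v := by
  have h : ((Equiv.Perm.sign τ : ℤ) : ℝ) * ((Equiv.Perm.sign τ : ℤ) : ℝ) = 1 := by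
    exact_mod_cast Int.units_coe_mul_self _
  unfold wedge
  rw [mul_left_comm]
  congr 1
  rw [Finset.mul_sum]
  refine Fintype.sum_equiv (Equiv.mulLeft τ) _ _ fun σ => ?_
  simp only [Equiv.coe_mulLeft, Equiv.Perm.coe_mul, Function.comp_apply, map_mul, Units.val_mul,
    Int.cast_mul]
  linear_combination (-((Equiv.Perm.sign σ : ℤ) : ℝ) * ((f fun i => v (τ (σ (Fin.castAdd q i)))) *
    g fun j => v (τ (σ (Fin.natAdd p j))))) * h

theorem Lambda2.apply_swap (γ : Lambda2) (x y : E8) : γ ![y, x] = -γ ![x, y] := by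
  rw [← γ.map_swap ![x, y] (i := 0) (j := 1) (by decide)]
  congr 1
  ext i : 1
  fin_cases i <;> rfl

theorem Lambda2.coe_eq (γ : Lambda2) : ⇑γ = fun w => γ ![w 0, w 1] := by
  ext w
  congr 1
  ext i : 1
  fin_cases i <;> rfl

theorem sum_perm_fin_four (F : Equiv.Perm (Fin 4) → ℝ) :
    ∑ σ, F σ = ∑ i : Fin 4, ∑ j : Fin 3, ∑ k : Fin 2, F (Equiv.Perm.decomposeFin.symm
      (i, Equiv.Perm.decomposeFin.symm (j, Equiv.Perm.decomposeFin.symm (k, 1)))) := by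
  rw [← Equiv.Perm.decomposeFin.symm.sum_comp, Fintype.sum_prod_type]
  refine Finset.sum_congr rfl fun i _ => ?_
  rw [← Equiv.Perm.decomposeFin.symm.sum_comp, Fintype.sum_prod_type]
  refine Finset.sum_congr rfl fun j _ => ?_
  rw [← Equiv.Perm.decomposeFin.symm.sum_comp, Fintype.sum_prod_type]
  refine Finset.sum_congr rfl fun k _ => ?_
  rw [Fintype.sum_unique]
  rfl

theorem wedge_two_two (α β : Lambda2) (v : Fin 4 → E8) :
    wedge (p := 2) (q := 2) α β v =
      α ![v 0, v 1] * β ![v 2, v 3] - α ![v 0, v 2] * β ![v 1, v 3]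
        + α ![v 0, v 3] * β ![v 1, v 2] + α ![v 1, v 2] * β ![v 0, v 3]
        - α ![v 1, v 3] * β ![v 0, v 2] + α ![v 2, v 3] * β ![v 0, v 1] := by
  have hα := α.apply_swap
  have hβ := β.apply_swap
  rw [α.coe_eq, β.coe_eq]
  generalize hA : (fun x y => α ![x, y]) = A
  generalize hB : (fun x y => β ![x, y]) = B
  simp only [funext_iff] at hA hB
  simp only [hA, hB] at *
  have h42 (p : Fin 4) (e : Equiv.Perm (Fin 3)) :
      Equiv.Perm.decomposeFin.symm (p, e) 2 = Equiv.swap 0 p (e 1).succ :=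
    Equiv.Perm.decomposeFin_symm_apply_succ e p 1
  have h43 (p : Fin 4) (e : Equiv.Perm (Fin 3)) :
      Equiv.Perm.decomposeFin.symm (p, e) 3 = Equiv.swap 0 p (e 2).succ :=
    Equiv.Perm.decomposeFin_symm_apply_succ e p 2
  have h32 (p : Fin 3) (e : Equiv.Perm (Fin 2)) :
      Equiv.Perm.decomposeFin.symm (p, e) 2 = Equiv.swap 0 p (e 1).succ :=
    Equiv.Perm.decomposeFin_symm_apply_succ e p 1
  unfold wedge
  erw [sum_perm_fin_four]
  simp [Fin.sum_univ_succ, h42, h43, h32, Equiv.swap_apply_def]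
  rw [hα (v 0) (v 1), hα (v 0) (v 2), hα (v 0) (v 3), hα (v 1) (v 2), hα (v 1) (v 3),
    hα (v 2) (v 3), hβ (v 0) (v 1), hβ (v 0) (v 2), hβ (v 0) (v 3), hβ (v 1) (v 2),
    hβ (v 1) (v 3), hβ (v 2) (v 3)]
  ring

theorem wedge_add_right {p q : ℕ} (f : (Fin p → E8) → ℝ) (g h : (Fin q → E8) → ℝ)
    (v : Fin (p + q) → E8) : wedge f (g + h) v = wedge f g v + wedge f h v := by
  simp only [wedge, Pi.add_apply, mul_add, Finset.sum_add_distrib]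

theorem wedge_sub_right {p q : ℕ} (f : (Fin p → E8) → ℝ) (g h : (Fin q → E8) → ℝ)
    (v : Fin (p + q) → E8) : wedge f (g - h) v = wedge f g v - wedge f h v := by
  simp only [wedge, Pi.sub_apply, mul_sub, Finset.sum_sub_distrib]

/-- The `(i, j)` coordinate of a 2-form. -/
def coord (γ : Lambda2) (i j : Fin 8) : ℝ :=
  γ ![EuclideanSpace.single i 1, EuclideanSpace.single j 1]

/-- The `(i, j, k, l)` coordinate of the wedge product of two 2-forms. -/
def wedgeCoord (α β : Lambda2) (i j k l : Fin 8) : ℝ :=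
  coord α i j * coord β k l - coord α i k * coord β j l + coord α i l * coord β j k
    + coord α j k * coord β i l - coord α j l * coord β i k + coord α k l * coord β i j

/-- The bilinear form `(α, β) ↦ *(α ∧ β ∧ Φ₀)` in coordinates. -/
def cayleyPairing (α β : Lambda2) : ℝ :=
  wedgeCoord α β 4 5 6 7 + wedgeCoord α β 2 3 6 7 + wedgeCoord α β 2 3 4 5
    + wedgeCoord α β 1 3 5 7 - wedgeCoord α β 1 3 4 6 - wedgeCoord α β 1 2 5 6
    - wedgeCoord α β 1 2 4 7 - wedgeCoord α β 0 3 5 6 - wedgeCoord α β 0 3 4 7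
    - wedgeCoord α β 0 2 5 7 + wedgeCoord α β 0 2 4 6 + wedgeCoord α β 0 1 6 7
    + wedgeCoord α β 0 1 4 5 + wedgeCoord α β 0 1 2 3

theorem cayleyPairing_comm (α β : Lambda2) : cayleyPairing α β = cayleyPairing β α := by
  unfold cayleyPairing wedgeCoord
  ring

theorem wedge_wedge_dx4 (α β : Lambda2) (s : Fin 8 → Fin 8) (hs : s.Bijective)
    (hsign : Equiv.Perm.sign (Equiv.ofBijective s hs) = 1) :
    wedge (wedge (p := 2) (q := 2) α β) (dx4 (s 4) (s 5) (s 6) (s 7))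
      (fun i => EuclideanSpace.single i 1) = wedgeCoord α β (s 0) (s 1) (s 2) (s 3) := by
  have h := wedge_dx4_single (wedge_comp_perm (p := 2) (q := 2) α β) (Equiv.ofBijective s hs)
  rw [hsign, wedge_two_two] at h
  simpa [wedgeCoord, coord] using h

theorem wedge_wedge_Phi0 (α β : Lambda2) :
    wedge (wedge (p := 2) (q := 2) α β) Phi0 (fun i => EuclideanSpace.single i 1) =
      cayleyPairing α β := by
  have hΦ : Phi0 = dx4 0 1 2 3 + dx4 0 1 4 5 + dx4 0 1 6 7 + dx4 0 2 4 6
      - dx4 0 2 5 7 - dx4 0 3 4 7 - dx4 0 3 5 6 - dx4 1 2 4 7 - dx4 1 2 5 6 - dx4 1 3 4 6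
      + dx4 1 3 5 7 + dx4 2 3 4 5 + dx4 2 3 6 7 + dx4 4 5 6 7 := rfl
  rw [hΦ]
  simp only [wedge_add_right, wedge_sub_right]
  unfold cayleyPairing
  iterate 13 congr 1
  · exact wedge_wedge_dx4 α β ![4, 5, 6, 7, 0, 1, 2, 3] (by decide) (by decide)
  · exact wedge_wedge_dx4 α β ![2, 3, 6, 7, 0, 1, 4, 5] (by decide) (by decide)
  · exact wedge_wedge_dx4 α β ![2, 3, 4, 5, 0, 1, 6, 7] (by decide) (by decide)
  · exact wedge_wedge_dx4 α β ![1, 3, 5, 7, 0, 2, 4, 6] (by decide) (by decide)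
  · exact wedge_wedge_dx4 α β ![1, 3, 4, 6, 0, 2, 5, 7] (by decide) (by decide)
  · exact wedge_wedge_dx4 α β ![1, 2, 5, 6, 0, 3, 4, 7] (by decide) (by decide)
  · exact wedge_wedge_dx4 α β ![1, 2, 4, 7, 0, 3, 5, 6] (by decide) (by decide)
  · exact wedge_wedge_dx4 α β ![0, 3, 5, 6, 1, 2, 4, 7] (by decide) (by decide)
  · exact wedge_wedge_dx4 α β ![0, 3, 4, 7, 1, 2, 5, 6] (by decide) (by decide)
  · exact wedge_wedge_dx4 α β ![0, 2, 5, 7, 1, 3, 4, 6] (by decide) (by decide)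
  · exact wedge_wedge_dx4 α β ![0, 2, 4, 6, 1, 3, 5, 7] (by decide) (by decide)
  · exact wedge_wedge_dx4 α β ![0, 1, 6, 7, 2, 3, 4, 5] (by decide) (by decide)
  · exact wedge_wedge_dx4 α β ![0, 1, 4, 5, 2, 3, 6, 7] (by decide) (by decide)
  · exact wedge_wedge_dx4 α β ![0, 1, 2, 3, 4, 5, 6, 7] (by decide) (by decide)

theorem vol_single : vol (fun i => EuclideanSpace.single i 1) = 1 := by
  rw [vol, ← Matrix.det_one (n := Fin 8)]
  congr 1
  ext a b
  simp [Matrix.one_apply]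

theorem Lambda2.ext_coord {α β : Lambda2} (h : ∀ i j, i < j → coord α i j = coord β i j) :
    α = β := by
  refine (EuclideanSpace.basisFun (Fin 8) ℝ).toBasis.ext_alternating fun v hv => ?_
  have hne : v 0 ≠ v 1 := hv.ne (by decide)
  rw [α.coe_eq, β.coe_eq]
  simp only [OrthonormalBasis.coe_toBasis, EuclideanSpace.basisFun_apply]
  rcases lt_or_gt_of_ne hne with hlt | hlt
  · exact h _ _ hlt
  · rw [α.apply_swap, β.apply_swap]
    exact congrArg Neg.neg (h _ _ hlt)

/-- The 2-form `dxⁱ ∧ dxʲ`. -/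
def dx2 (i j : Fin 8) : Lambda2 :=
  (Matrix.detRowAlternating (R := ℝ) (n := Fin 2)).compLinearMap
    (LinearMap.pi ![(EuclideanSpace.proj i : E8 →L[ℝ] ℝ).toLinearMap,
      (EuclideanSpace.proj j : E8 →L[ℝ] ℝ).toLinearMap])

theorem coord_dx2 (i j k l : Fin 8) : coord (dx2 i j) k l =
    (if i = k then 1 else 0) * (if j = l then 1 else 0)
      - (if j = k then 1 else 0) * (if i = l then 1 else 0) := by
  have : coord (dx2 i j) k l = Matrix.det (Matrix.of fun a b =>
      (![EuclideanSpace.single k 1, EuclideanSpace.single l 1] a : E8) (![i, j] b)) := by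
    unfold coord dx2
    rw [AlternatingMap.compLinearMap_apply]
    show Matrix.det _ = _
    congr 1
    ext a b
    fin_cases a <;> fin_cases b <;> simp
  rw [this, Matrix.det_fin_two]
  simp [PiLp.single_apply, mul_comm]

theorem coord_dx2_of_lt {i j k l : Fin 8} (hij : i < j) (hkl : k < l) : coord (dx2 i j) k l =
    if k = i ∧ l = j then 1 else 0 := by
  rw [coord_dx2]
  grind

theorem ip2_dx2 (γ : Lambda2) {i j : Fin 8} (hij : i < j) : ip2 γ (dx2 i j) = coord γ i j := by
  have h (k l : Fin 8) : (if k < l then coord γ k l * coord (dx2 i j) k l else 0) =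
      if k = i then if l = j then coord γ i j else 0 else 0 := by
    split_ifs with hkl hk hl hk hl <;> first | rw [coord_dx2_of_lt hij hkl] | skip
    all_goals grind
  change ∑ k, ∑ l, (if k < l then coord γ k l * coord (dx2 i j) k l else 0) = _
  simp [h]

theorem coord_sum_dx2 (c : {p : Fin 8 × Fin 8 // p.1 < p.2} → ℝ)
    (q : {p : Fin 8 × Fin 8 // p.1 < p.2}) :
    coord (∑ p, c p • dx2 p.1.1 p.1.2) q.1.1 q.1.2 = c q := by
  have h (p : {p : Fin 8 × Fin 8 // p.1 < p.2}) :
      coord (dx2 p.1.1 p.1.2) q.1.1 q.1.2 = if p = q then 1 else 0 := by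
    rw [coord_dx2_of_lt p.2 q.2]
    simp only [Subtype.ext_iff, Prod.ext_iff, eq_comm]
  have hsum : coord (∑ p, c p • dx2 p.1.1 p.1.2) q.1.1 q.1.2 =
      ∑ p, c p * coord (dx2 p.1.1 p.1.2) q.1.1 q.1.2 :=
    map_sum (AddMonoidHom.mk' (fun γ : Lambda2 => coord γ q.1.1 q.1.2) fun _ _ => rfl)
      (fun p : {p : Fin 8 × Fin 8 // p.1 < p.2} => c p • dx2 p.1.1 p.1.2) Finset.univ
  simp [hsum, h]

/-- A 2-form is determined by its coordinates above the diagonal. -/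
def coordEquiv : Lambda2 ≃ₗ[ℝ] ({p : Fin 8 × Fin 8 // p.1 < p.2} → ℝ) where
  toFun γ p := coord γ p.1.1 p.1.2
  map_add' _ _ := rfl
  map_smul' _ _ := rfl
  invFun c := ∑ p, c p • dx2 p.1.1 p.1.2
  left_inv γ := Lambda2.ext_coord fun i j hij =>
    coord_sum_dx2 (fun p => coord γ p.1.1 p.1.2) ⟨(i, j), hij⟩
  right_inv c := funext fun q => coord_sum_dx2 c q

/-- The basis `dxⁱ ∧ dxʲ`, `i < j`, of the space of 2-forms. -/
def dx2Basis : Module.Basis {p : Fin 8 × Fin 8 // p.1 < p.2} ℝ Lambda2 :=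
  .ofEquivFun coordEquiv

theorem dx2Basis_repr (γ : Lambda2) (p : {p : Fin 8 × Fin 8 // p.1 < p.2}) :
    dx2Basis.repr γ p = coord γ p.1.1 p.1.2 := rfl

theorem dx2Basis_apply (p : {p : Fin 8 × Fin 8 // p.1 < p.2}) :
    dx2Basis p = dx2 p.1.1 p.1.2 := by
  simp [dx2Basis, coordEquiv, Pi.single_apply]

theorem finrank_Lambda2 : Module.finrank ℝ Lambda2 = 28 := by
  rw [Module.finrank_eq_card_basis dx2Basis]
  decide

theorem cayleyPairing_dx2_self {i j : Fin 8} (hij : i < j) :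
    cayleyPairing (dx2 i j) (dx2 i j) = 0 := by
  have h {a b c d : Fin 8} (hab : a < b) (hbc : b < c) (hcd : c < d) :
      wedgeCoord (dx2 i j) (dx2 i j) a b c d = 0 := by
    simp only [wedgeCoord, coord_dx2_of_lt hij, hab, hbc, hcd, hab.trans hbc, hbc.trans hcd,
      (hab.trans hbc).trans hcd]
    grind
  simp (disch := decide) only [cayleyPairing, h]
  norm_num

section Operator

variable {T : Lambda2 →ₗ[ℝ] Lambda2}

theorem coord_eq_cayleyPairing (hT : ∀ α β, ip2 (T α) β = cayleyPairing α β) (α : Lambda2)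
    {i j : Fin 8} (hij : i < j) : coord (T α) i j = cayleyPairing α (dx2 i j) := by
  rw [← hT, ip2_dx2 _ hij]

theorem trace_eq_zero (hT : ∀ α β, ip2 (T α) β = cayleyPairing α β) :
    LinearMap.trace ℝ Lambda2 T = 0 := by
  rw [LinearMap.trace_eq_matrix_trace ℝ dx2Basis, Matrix.trace]
  refine Finset.sum_eq_zero fun p _ => ?_
  rw [Matrix.diag_apply, LinearMap.toMatrix_apply, dx2Basis_repr, dx2Basis_apply,
    coord_eq_cayleyPairing hT _ p.2, cayleyPairing_dx2_self p.2]

theorem apply_apply_eq (hT : ∀ α β, ip2 (T α) β = cayleyPairing α β) (α : Lambda2) :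
    T (T α) = (2 : ℝ) • T α + (3 : ℝ) • α := by
  refine Lambda2.ext_coord fun i j hij => ?_
  have hsmul : coord ((2 : ℝ) • T α + (3 : ℝ) • α) i j = 2 * coord (T α) i j + 3 * coord α i j :=
    rfl
  rw [hsmul, coord_eq_cayleyPairing hT _ hij, coord_eq_cayleyPairing hT _ hij]
  fin_cases i <;> fin_cases j <;> first | exact absurd hij (by decide) | skip
  all_goals
    simp only [cayleyPairing, wedgeCoord, coord_dx2, Fin.reduceEq, Fin.reduceFinMk, Fin.zero_eta,
      Fin.isValue, Fin.mk_one, if_true, if_false, mul_zero, mul_one, sub_zero, add_zero, zero_add,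
      zero_sub, sub_self]
    simp (disch := decide) only [coord_eq_cayleyPairing hT]
    simp only [cayleyPairing, wedgeCoord, coord_dx2, Fin.reduceEq, if_true, if_false, mul_zero,
      mul_one, sub_zero, add_zero, zero_add, zero_sub, sub_self]
    ring

end Operator

theorem isProj_eigenspace {V : Type*} [AddCommGroup V] [Module ℝ V] {S : Module.End ℝ V} {a b : ℝ}
    (hab : a ≠ b) (hS : ∀ x, S (S x) = (a + b) • S x - (a * b) • x) :
    LinearMap.IsProj (S.eigenspace a) ((a - b)⁻¹ • (S - b • LinearMap.id)) where
  map_mem x := by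
    rw [Module.End.mem_eigenspace_iff]
    simp only [LinearMap.smul_apply, LinearMap.sub_apply, LinearMap.id_apply, map_smul, map_sub, hS]
    module
  map_id x hx := by
    rw [Module.End.mem_eigenspace_iff] at hx
    simp only [LinearMap.smul_apply, LinearMap.sub_apply, LinearMap.id_apply, hx]
    rw [← sub_smul, inv_smul_smul₀ (sub_ne_zero.mpr hab)]

theorem isCompl_eigenspace {V : Type*} [AddCommGroup V] [Module ℝ V] {S : Module.End ℝ V} {a b : ℝ}
    (hab : a ≠ b) (hS : ∀ x, S (S x) = (a + b) • S x - (a * b) • x) :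
    IsCompl (S.eigenspace a) (S.eigenspace b) := by
  have h := (isProj_eigenspace hab hS).isCompl
  suffices hk : LinearMap.ker ((a - b)⁻¹ • (S - b • LinearMap.id)) = S.eigenspace b by rwa [hk] at h
  rw [LinearMap.ker_smul _ _ (inv_ne_zero (sub_ne_zero.mpr hab)), Module.End.eigenspace_def]
  rfl

theorem finrank_eigenspace {V : Type*} [AddCommGroup V] [Module ℝ V] [FiniteDimensional ℝ V]
    {S : Module.End ℝ V} {a b : ℝ}
    (hab : a ≠ b) (hS : ∀ x, S (S x) = (a + b) • S x - (a * b) • x) :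
    (Module.finrank ℝ (S.eigenspace a) : ℝ) =
      (a - b)⁻¹ * (LinearMap.trace ℝ V S - b * Module.finrank ℝ V) := by
  rw [← (isProj_eigenspace hab hS).trace]
  simp

/-- The operator `T` on `Λ²(ℝ⁸)*` defined by
`α ∧ β ∧ Φ₀ = ⟨T α, β⟩ · vol` is self-adjoint, and `Λ²` is the orthogonal direct sum of
the eigenspace `Λ²₇` of `T` for the eigenvalue `3` (of dimension 7) and the eigenspace
`Λ²₂₁` for the eigenvalue `−1` (of dimension 21). -/
theorem two_forms_eigenspace_decomposition (T : Lambda2 →ₗ[ℝ] Lambda2)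
    (hT : ∀ α β : Lambda2, ∀ v : Fin 8 → E8,
      wedge (wedge ⇑α ⇑β) Phi0 v = ip2 (T α) β * vol v) :
    (∀ α β : Lambda2, ip2 (T α) β = ip2 α (T β)) ∧
    Module.finrank ℝ (Module.End.eigenspace T 3) = 7 ∧
    Module.finrank ℝ (Module.End.eigenspace T (-1)) = 21 ∧
    IsCompl (Module.End.eigenspace T 3) (Module.End.eigenspace T (-1)) ∧
    (∀ α ∈ Module.End.eigenspace T 3, ∀ β ∈ Module.End.eigenspace T (-1),
      ip2 α β = 0) := by
  have hQ (α β : Lambda2) : ip2 (T α) β = cayleyPairing α β := by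
    rw [← wedge_wedge_Phi0, hT, vol_single, mul_one]
  have hcomm (α β : Lambda2) : ip2 α β = ip2 β α := by
    simp only [ip2, mul_comm]
  have hself (α β : Lambda2) : ip2 (T α) β = ip2 α (T β) := by
    rw [hQ, hcomm, hQ, cayleyPairing_comm]
  have hsmul (c : ℝ) (α β : Lambda2) : ip2 (c • α) β = c * ip2 α β := by
    simp only [ip2, AlternatingMap.smul_apply, smul_eq_mul, Finset.mul_sum, mul_ite, mul_zero,
      mul_assoc]
  have hS (α : Lambda2) : T (T α) = ((3 : ℝ) + -1) • T α - ((3 : ℝ) * -1) • α := by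
    rw [apply_apply_eq hQ]
    module
  have hS' (α : Lambda2) : T (T α) = (-1 + (3 : ℝ)) • T α - (-1 * (3 : ℝ)) • α := by
    rw [apply_apply_eq hQ]
    module
  have : FiniteDimensional ℝ Lambda2 := dx2Basis.finiteDimensional_of_finite
  have h3 : (3 : ℝ) ≠ -1 := by norm_num
  refine ⟨hself, ?_, ?_, isCompl_eigenspace h3 hS, fun α hα β hβ => ?_⟩
  · have h := finrank_eigenspace h3 hS
    rw [trace_eq_zero hQ, finrank_Lambda2] at h
    norm_num at h
    exact_mod_cast h
  · have h := finrank_eigenspace h3.symm hS'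
    rw [trace_eq_zero hQ, finrank_Lambda2] at h
    norm_num at h
    exact_mod_cast h
  · have h := hself α β
    rw [Module.End.mem_eigenspace_iff] at hα hβ
    rw [hα, hβ, hsmul, hcomm α (_ • β), hsmul, hcomm β] at h
    linarith
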